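/- Assume F satisfies (F1), (F2) and (F3). Then there exists κ > 0 such that for every c ∈ [a,b) and every continuous f : [a,b] → ℝ, the mixed problem F(u''(t), u'(t), u(t), t) − κ·u(t) = f(t) for t ∈ (a,b), with u'(c) = 0 and u(b) = 0, has a unique solution u ∈ C²(a,b) ∩ C¹([a,b]). -/

import Mathlib

open Set

/-- `u ∈ C²(a,b) ∩ C¹([a,b])`, with first derivative `u'` (one-sided at the endpoints)
and second derivative `u''` on the open interval. -/
def C2Fun (a b : ℝ) (u u' u'' : ℝ → ℝ) : Prop :=
  (∀ t ∈ Set.Icc a b, HasDerivWithinAt u (u' t) (Set.Icc a b) t) ∧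
  ContinuousOn u' (Set.Icc a b) ∧
  (∀ t ∈ Set.Ioo a b, HasDerivAt u' (u'' t) t) ∧
  ContinuousOn u'' (Set.Ioo a b)

open Filter Topology
open scoped NNReal

section LinearGrowth

variable {E : Type*} [NormedAddCommGroup E] [NormedSpace ℝ E]

/-- Two-sided Grönwall estimate on a compact interval, from an arbitrary initial time. -/
lemma norm_le_gronwallBound_of_norm_derivWithin_Icc_le {α β : ℝ → E} {a b t₀ K M : ℝ}
    (hK : 0 ≤ K) (hM : 0 ≤ M) (ht₀ : t₀ ∈ Icc a b)
    (hα : ∀ t ∈ Icc a b, HasDerivWithinAt α (β t) (Icc a b) t)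
    (hβ : ∀ t ∈ Icc a b, ‖β t‖ ≤ K * ‖α t‖ + M) :
    ∀ t ∈ Icc a b, ‖α t‖ ≤ gronwallBound ‖α t₀‖ K M (b - a) := by
  have hcont : ContinuousOn α (Icc a b) := fun t ht => (hα t ht).continuousWithinAt
  have hmono := gronwallBound_mono (norm_nonneg (α t₀)) hM hK
  intro t ht
  rcases le_total t₀ t with h | h
  · refine (norm_le_gronwallBound_of_norm_deriv_right_le (f' := β) (a := t₀) (b := b)
      (hcont.mono (Icc_subset_Icc_left ht₀.1)) (fun x hx => ?_) le_rfl
      (fun x hx => hβ x ⟨ht₀.1.trans hx.1, hx.2.le⟩) t ⟨h, ht.2⟩).trans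
      (hmono (by linarith [ht.2, ht₀.1]))
    have hx' : x ∈ Ico a b := ⟨ht₀.1.trans hx.1, hx.2⟩
    exact (hα x (Ico_subset_Icc_self hx')).mono_of_mem_nhdsWithin (Icc_mem_nhdsGE_of_mem hx')
  · have hmaps : MapsTo (fun s : ℝ => -s) (Icc (-t₀) (-a)) (Icc a b) := fun s hs =>
      ⟨by linarith [hs.2], by linarith [hs.1, ht₀.2]⟩
    have key := norm_le_gronwallBound_of_norm_deriv_right_le (f := fun s => α (-s))
      (f' := fun s => -β (-s)) (a := -t₀) (b := -a) (δ := ‖α t₀‖) (K := K) (ε := M)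
      (hcont.comp continuousOn_neg hmaps) (fun x hx => ?_) (by simp)
      (fun x hx => by simpa using hβ (-x) (hmaps (Ico_subset_Icc_self hx)))
      (-t) ⟨by linarith, by linarith [ht.1]⟩
    · simp only [neg_neg] at key
      exact key.trans (hmono (by linarith [ht.1, ht₀.2]))
    · have hx' : -x ∈ Ioc a b := ⟨by linarith [hx.2], by linarith [hx.1, ht₀.2]⟩
      have h1 : HasDerivWithinAt α (β (-x)) (Iic (-x)) (-x) :=
        (hα _ (Ioc_subset_Icc_self hx')).mono_of_mem_nhdsWithin (Icc_mem_nhdsLE_of_mem hx')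
      have h2 := h1.scomp x (hasDerivAt_neg x).hasDerivWithinAt
        (fun y (hy : x ≤ y) => neg_le_neg hy)
      rwa [neg_one_smul] at h2

end LinearGrowth

section Clamp

variable {R x y : ℝ}

lemma abs_max_neg_min_sub_le : |max (-R) (min R x) - max (-R) (min R y)| ≤ |x - y| :=
  (abs_max_sub_max_le_max _ _ _ _).trans <| by
    have := abs_min_sub_min_le_max R x R y
    simp only [sub_self, abs_zero] at this ⊢
    simpa using this

lemma max_neg_min_eq_self (h : |x| ≤ R) : max (-R) (min R x) = x := by
  rw [min_eq_right (abs_le.1 h).2, max_eq_right (abs_le.1 h).1]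

lemma abs_max_neg_min_le (hR : 0 ≤ R) : |max (-R) (min R x)| ≤ R :=
  abs_le.2 ⟨le_max_left _ _, max_le (by linarith) (min_le_left _ _)⟩

end Clamp

/-- Global existence for the initial value problem of a globally Lipschitz planar field. -/
lemma exists_hasDerivWithinAt_Icc_of_lipschitzWith {a b t₀ : ℝ} {K : ℝ≥0}
    {V : ℝ → ℝ × ℝ → ℝ × ℝ} (hV : ∀ t ∈ Icc a b, LipschitzWith K (V t))
    (hc : ∀ x, ContinuousOn (fun t => V t x) (Icc a b)) (ht₀ : t₀ ∈ Icc a b) (x₀ : ℝ × ℝ) :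
    ∃ α : ℝ → ℝ × ℝ, α t₀ = x₀ ∧
      ∀ t ∈ Icc a b, HasDerivWithinAt α (V t (α t)) (Icc a b) t := by
  obtain ⟨M, hM⟩ := isCompact_Icc.exists_bound_of_continuousOn (hc 0)
  have hM0 : 0 ≤ M := (norm_nonneg _).trans (hM t₀ ht₀)
  have hgrowth : ∀ t ∈ Icc a b, ∀ x, ‖V t x‖ ≤ K * ‖x‖ + M := fun t ht x => by
    have h1 := (hV t ht).dist_le_mul x 0
    rw [dist_eq_norm, dist_zero_right] at h1
    linarith [norm_le_norm_add_norm_sub' (V t x) (V t 0), hM t ht]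
  have hab : 0 ≤ b - a := by linarith [ht₀.1, ht₀.2]
  obtain ⟨R, hR⟩ : ∃ R : ℝ, R = gronwallBound ‖x₀‖ K M (b - a) := ⟨_, rfl⟩
  have hR0 : 0 ≤ R := by
    have := gronwallBound_mono (norm_nonneg x₀) hM0 K.coe_nonneg hab
    rw [gronwallBound_x0, ← hR] at this
    exact (norm_nonneg x₀).trans this
  let P : ℝ × ℝ → ℝ × ℝ := fun x => (max (-R) (min R x.1), max (-R) (min R x.2))
  have hPlip : LipschitzWith 1 P := LipschitzWith.of_dist_le_mul fun x y => by
    simp only [P, Prod.dist_eq, Real.dist_eq, NNReal.coe_one, one_mul]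
    exact max_le_max abs_max_neg_min_sub_le abs_max_neg_min_sub_le
  have hPself : ∀ x, ‖x‖ ≤ R → P x = x := fun x hx => by
    rw [Prod.norm_def, max_le_iff] at hx
    exact Prod.ext (max_neg_min_eq_self hx.1) (max_neg_min_eq_self hx.2)
  have hPR : ∀ x, ‖P x‖ ≤ R := fun x =>
    max_le (abs_max_neg_min_le hR0) (abs_max_neg_min_le hR0)
  have hPle : ∀ x, ‖P x‖ ≤ ‖x‖ := fun x => by
    have h1 := hPlip.dist_le_mul x 0
    rw [hPself 0 (by simpa using hR0)] at h1
    simpa using h1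
  lift M to ℝ≥0 using hM0
  lift R to ℝ≥0 using hR0
  have hPL : IsPicardLindelof (fun t x => V t (P x)) (⟨t₀, ht₀⟩ : Icc a b) x₀
      ((K * R + M) * NNReal.mk (b - a) hab) 0 (K * R + M) K :=
    { lipschitzOnWith := fun t ht => by
        have := (hV t ht).comp hPlip
        rw [mul_one] at this
        exact this.lipschitzOnWith
      continuousOn := fun x _ => hc (P x)
      norm_le := fun t ht x _ => by
        have := hgrowth t ht (P x)
        have h2 := mul_le_mul_of_nonneg_left (hPR x) K.coe_nonneg
        push_cast
        exact this.trans (by linarith)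
      mul_max_le := by
        push_cast
        rw [sub_zero]
        refine mul_le_mul_of_nonneg_left (max_le ?_ ?_) (by positivity)
        · exact sub_le_sub_left ht₀.1 b
        · exact sub_le_sub_right ht₀.2 a }
  obtain ⟨α, hα0, hα⟩ := hPL.exists_eq_forall_mem_Icc_hasDerivWithinAt₀
  have hbound := norm_le_gronwallBound_of_norm_derivWithin_Icc_le K.coe_nonneg M.coe_nonneg ht₀ hα
    (fun t ht => (hgrowth t ht _).trans
      (add_le_add_left (mul_le_mul_of_nonneg_left (hPle (α t)) K.coe_nonneg) _))
  refine ⟨α, hα0, fun t ht => ?_⟩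
  have h1 := hα t ht
  rwa [hPself (α t)] at h1
  have h2 := hbound t ht
  simp only at hα0
  rw [hα0] at h2
  exact h2.trans hR.ge

/-- The initial data determine a trajectory of a Lipschitz field on both sides of the
initial time. -/
lemma eqOn_Icc_of_hasDerivWithinAt {a b c : ℝ} {K : ℝ≥0} {V : ℝ → ℝ × ℝ → ℝ × ℝ}
    (hV : ∀ t ∈ Icc a b, LipschitzWith K (V t)) (hc : c ∈ Icc a b) {α β : ℝ → ℝ × ℝ}
    (hα : ∀ t ∈ Icc a b, HasDerivWithinAt α (V t (α t)) (Icc a b) t)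
    (hβ : ∀ t ∈ Icc a b, HasDerivWithinAt β (V t (β t)) (Icc a b) t)
    (h : α c = β c) : EqOn α β (Icc a b) := by
  have hright : ∀ γ : ℝ → ℝ × ℝ,
      (∀ t ∈ Icc a b, HasDerivWithinAt γ (V t (γ t)) (Icc a b) t) →
      ∀ t ∈ Ico c b, HasDerivWithinAt γ (V t (γ t)) (Ici t) t := fun γ hγ t ht =>
    (hγ t ⟨hc.1.trans ht.1, ht.2.le⟩).mono_of_mem_nhdsWithin
      (Icc_mem_nhdsGE_of_mem ⟨hc.1.trans ht.1, ht.2⟩)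
  have hleft : ∀ γ : ℝ → ℝ × ℝ,
      (∀ t ∈ Icc a b, HasDerivWithinAt γ (V t (γ t)) (Icc a b) t) →
      ∀ t ∈ Ioc a c, HasDerivWithinAt γ (V t (γ t)) (Iic t) t := fun γ hγ t ht =>
    (hγ t ⟨ht.1.le, ht.2.trans hc.2⟩).mono_of_mem_nhdsWithin
      (Icc_mem_nhdsLE_of_mem ⟨ht.1, ht.2.trans hc.2⟩)
  have hcα : ContinuousOn α (Icc a b) := fun t ht => (hα t ht).continuousWithinAt
  have hcβ : ContinuousOn β (Icc a b) := fun t ht => (hβ t ht).continuousWithinAt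
  rw [← Icc_union_Icc_eq_Icc hc.1 hc.2]
  refine EqOn.union ?_ ?_
  · exact ODE_solution_unique_of_mem_Icc_left (s := fun _ => univ)
      (fun t ht => (hV t ⟨ht.1.le, ht.2.trans hc.2⟩).lipschitzOnWith)
      (hcα.mono (Icc_subset_Icc_right hc.2)) (hleft α hα) (fun _ _ => mem_univ _)
      (hcβ.mono (Icc_subset_Icc_right hc.2)) (hleft β hβ) (fun _ _ => mem_univ _) h
  · exact ODE_solution_unique_of_mem_Icc_right (s := fun _ => univ)
      (fun t ht => (hV t ⟨hc.1.trans ht.1, ht.2.le⟩).lipschitzOnWith)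
      (hcα.mono (Icc_subset_Icc_left hc.1)) (hright α hα) (fun _ _ => mem_univ _)
      (hcβ.mono (Icc_subset_Icc_left hc.1)) (hright β hβ) (fun _ _ => mem_univ _) h

/-- Maximum principle: a function with `w' c = 0`, which is strictly convex at its positive
critical points, ends above its positive initial value. -/
lemma le_right_of_critical_convex {b c : ℝ} {w w' w'' : ℝ → ℝ} (hcb : c ≤ b)
    (hw : ∀ t ∈ Icc c b, HasDerivWithinAt w (w' t) (Icc c b) t)
    (hw' : ∀ t ∈ Icc c b, HasDerivWithinAt w' (w'' t) (Icc c b) t)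
    (hc : w' c = 0) (hpos : 0 < w c)
    (hconv : ∀ t ∈ Icc c b, 0 < w t → w' t = 0 → 0 < w'' t) : w c ≤ w b := by
  by_contra! hlt
  have hcont : ContinuousOn w (Icc c b) := fun t ht => (hw t ht).continuousWithinAt
  obtain ⟨s, hs, hmax⟩ := isCompact_Icc.exists_isMaxOn (nonempty_Icc.2 hcb) hcont
  have hsc : w c ≤ w s := hmax (left_mem_Icc.2 hcb)
  have hsb : s < b := lt_of_le_of_ne hs.2 (by rintro rfl; linarith)
  have hcrit : w' s = 0 := by
    rcases hs.1.eq_or_lt with rfl | h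
    · exact hc
    · have hnhds : Icc c b ∈ 𝓝 s := Icc_mem_nhds h hsb
      exact (hmax.isLocalMax hnhds).hasDerivAt_eq_zero ((hw s hs).hasDerivAt hnhds)
  have hq := hconv s hs (hpos.trans_le hsc) hcrit
  have hd : HasDerivWithinAt w' (w'' s) (Ioi s) s :=
    ((hw' s hs).mono_of_mem_nhdsWithin (Icc_mem_nhdsGE_of_mem ⟨hs.1, hsb⟩)).mono
      Ioi_subset_Ici_self
  rw [hasDerivWithinAt_iff_tendsto_slope' self_notMem_Ioi] at hd
  have hev : ∀ᶠ t in 𝓝[>] s, 0 < w' t := by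
    filter_upwards [hd.eventually_const_lt hq, self_mem_nhdsWithin] with t ht hst
    rw [slope_def_field, hcrit, sub_zero] at ht
    exact (div_pos_iff_of_pos_right (sub_pos.2 hst)).1 ht
  obtain ⟨r, hr, hrs⟩ := mem_nhdsGT_iff_exists_Ioc_subset.1 hev
  have hsr : s < min r b := lt_min hr hsb
  have hsub : Icc s (min r b) ⊆ Icc c b := Icc_subset_Icc hs.1 (min_le_right _ _)
  have hmono : StrictMonoOn w (Icc s (min r b)) := by
    refine strictMonoOn_of_hasDerivWithinAt_pos (f' := w') (convex_Icc _ _) (hcont.mono hsub)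
      (fun x hx => ?_) (fun x hx => ?_)
    · exact (hw x (hsub (interior_subset hx))).mono (interior_subset.trans hsub)
    · rw [interior_Icc] at hx
      exact hrs ⟨hx.1, hx.2.le.trans (min_le_left _ _)⟩
  exact absurd (hmono (left_mem_Icc.2 hsr.le) (right_mem_Icc.2 hsr.le) hsr)
    (not_lt.2 (hmax (hsub (right_mem_Icc.2 hsr.le))))

/-- A continuous function on the line expanding by a factor `k > 0` is onto. -/
lemma surjective_of_continuous_of_expanding {φ : ℝ → ℝ} {k : ℝ} (hk : 0 < k)
    (hφ : Continuous φ) (h : ∀ x y, x ≤ y → k * (y - x) ≤ φ y - φ x) :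
    Function.Surjective φ := by
  intro y
  have hz : 0 ≤ |y - φ 0| / k := by positivity
  have hk' : k * (|y - φ 0| / k) = |y - φ 0| := mul_div_cancel₀ _ hk.ne'
  have h1 := h 0 _ hz
  have h2 := h _ 0 (neg_nonpos.2 hz)
  refine mem_range_of_exists_le_of_exists_ge hφ ⟨-(|y - φ 0| / k), ?_⟩ ⟨|y - φ 0| / k, ?_⟩
  · linarith [neg_abs_le (y - φ 0)]
  · linarith [le_abs_self (y - φ 0)]

/-- If the derivative in the open interval extends continuously to the closed interval, then
it is also the one-sided derivative at the endpoints. -/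
lemma hasDerivWithinAt_Icc_of_continuousOn {a b : ℝ} {f g : ℝ → ℝ} (hab : a < b)
    (hf : ContinuousOn f (Icc a b)) (hfg : ∀ t ∈ Ioo a b, HasDerivAt f (g t) t)
    (hg : ContinuousOn g (Icc a b)) :
    ∀ t ∈ Icc a b, HasDerivWithinAt f (g t) (Icc a b) t := by
  have hdiff : DifferentiableOn ℝ f (Ioo a b) := fun t ht =>
    (hfg t ht).differentiableAt.differentiableWithinAt
  intro t ht
  rcases ht.1.eq_or_lt with rfl | hat
  · have hmem : Ioo a b ∈ 𝓝[>] a := Ioo_mem_nhdsGT hab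
    refine (hasDerivWithinAt_Ici_of_tendsto_deriv hdiff
      ((hf a ht).mono Ioo_subset_Icc_self) hmem ?_).mono Icc_subset_Ici_self
    refine Tendsto.congr' (f₁ := g) ?_ ((hg a ht).mono_left ?_)
    · filter_upwards [hmem] with x hx using (hfg x hx).deriv.symm
    · exact nhdsWithin_le_of_mem (mem_of_superset hmem Ioo_subset_Icc_self)
  rcases ht.2.eq_or_lt with rfl | htb
  · have hmem : Ioo a t ∈ 𝓝[<] t := Ioo_mem_nhdsLT hab
    refine (hasDerivWithinAt_Iic_of_tendsto_deriv hdiff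
      ((hf t ht).mono Ioo_subset_Icc_self) hmem ?_).mono Icc_subset_Iic_self
    refine Tendsto.congr' (f₁ := g) ?_ ((hg t ht).mono_left ?_)
    · filter_upwards [hmem] with x hx using (hfg x hx).deriv.symm
    · exact nhdsWithin_le_of_mem (mem_of_superset hmem Ioo_subset_Icc_self)
  · exact (hfg t ⟨hat, htb⟩).hasDerivWithinAt

/-- The mixed problem `u'' = g(t, u, u')`, `u'(c) = 0`, `u(b) = 0`, for a Lipschitz nonlinearity
which is strictly increasing in `u`. -/
lemma exists_unique_mixed_problem {a b c : ℝ} (hc : c ∈ Ico a b) {g : ℝ → ℝ → ℝ → ℝ} {K : ℝ≥0}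
    (hlip : ∀ t ∈ Icc a b, ∀ x p y q, |g t x p - g t y q| ≤ K * max |x - y| |p - q|)
    (hcont : ∀ x p : ℝ → ℝ, ContinuousOn x (Icc a b) → ContinuousOn p (Icc a b) →
      ContinuousOn (fun t => g t (x t) (p t)) (Icc a b))
    (hmono : ∀ t ∈ Icc a b, ∀ p x y, x < y → g t x p < g t y p) :
    ∃ u u' u'' : ℝ → ℝ,
      (C2Fun a b u u' u'' ∧ (∀ t ∈ Ioo a b, u'' t = g t (u t) (u' t)) ∧ u' c = 0 ∧ u b = 0) ∧
      ∀ v v' v'' : ℝ → ℝ, C2Fun a b v v' v'' → (∀ t ∈ Ioo a b, v'' t = g t (v t) (v' t)) →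
        v' c = 0 → v b = 0 → ∀ t ∈ Icc a b, v t = u t := by
  have hab : a < b := hc.1.trans_lt hc.2
  have hc' : c ∈ Icc a b := Ico_subset_Icc_self hc
  let V : ℝ → ℝ × ℝ → ℝ × ℝ := fun t x => (x.2, g t x.1 x.2)
  have hV : ∀ t ∈ Icc a b, LipschitzWith (max 1 K) (V t) := fun t ht =>
    LipschitzWith.prodMk LipschitzWith.prod_snd
      (LipschitzWith.of_dist_le_mul fun x y => hlip t ht _ _ _ _)
  have hVc : ∀ x, ContinuousOn (fun t => V t x) (Icc a b) := fun x =>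
    continuousOn_const.prodMk (hcont _ _ continuousOn_const continuousOn_const)
  choose α hα0 hα using fun d : ℝ =>
    exists_hasDerivWithinAt_Icc_of_lipschitzWith hV hVc hc' (d, 0)
  have hα1 : ∀ d, ∀ t ∈ Icc a b,
      HasDerivWithinAt (fun t => (α d t).1) ((α d t).2) (Icc a b) t := fun d t ht =>
    (hα d t ht).fst
  have hα2 : ∀ d, ∀ t ∈ Icc a b, HasDerivWithinAt (fun t => (α d t).2)
      (g t (α d t).1 (α d t).2) (Icc a b) t := fun d t ht => (hα d t ht).snd
  have hcb : Icc c b ⊆ Icc a b := Icc_subset_Icc_left hc.1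
  have hexpand : ∀ d e, d ≤ e → 1 * (e - d) ≤ (α e b).1 - (α d b).1 := by
    intro d e hde
    rcases hde.eq_or_lt with rfl | hlt
    · simp
    have := le_right_of_critical_convex (w := fun t => (α e t).1 - (α d t).1)
      (w' := fun t => (α e t).2 - (α d t).2)
      (w'' := fun t => g t (α e t).1 (α e t).2 - g t (α d t).1 (α d t).2) hc.2.le
      (fun t ht => ((hα1 e t (hcb ht)).sub (hα1 d t (hcb ht))).mono hcb)
      (fun t ht => ((hα2 e t (hcb ht)).sub (hα2 d t (hcb ht))).mono hcb)
      (by simp [hα0]) (by simpa [hα0] using hlt) (fun t ht h1 h2 => by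
        rw [sub_eq_zero.1 h2]
        exact sub_pos.2 (hmono t (hcb ht) _ _ _ (sub_pos.1 h1)))
    simpa [hα0] using this
  have hcontφ : Continuous fun d => (α d b).1 := by
    have hL : LipschitzWith (Real.toNNReal (Real.exp ((max 1 K : ℝ≥0) * (b - c))))
        fun d => α d b := by
      refine LipschitzWith.of_dist_le_mul fun d e => ?_
      have hder : ∀ d, ∀ t ∈ Ico c b, HasDerivWithinAt (α d) (V t (α d t)) (Ici t) t :=
        fun d t ht => (hα d t (hcb (Ico_subset_Icc_self ht))).mono_of_mem_nhdsWithin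
          (Icc_mem_nhdsGE_of_mem ⟨hc.1.trans ht.1, ht.2⟩)
      have hco : ∀ d, ContinuousOn (α d) (Icc c b) := fun d t ht =>
        (hα d t (hcb ht)).continuousWithinAt.mono hcb
      have := dist_le_of_trajectories_ODE_of_mem (s := fun _ => univ)
        (fun t ht => (hV t (hcb (Ico_subset_Icc_self ht))).lipschitzOnWith)
        (hco d) (hder d) (fun _ _ => mem_univ _) (hco e) (hder e) (fun _ _ => mem_univ _)
        le_rfl b (right_mem_Icc.2 hc.2.le)
      rw [Real.coe_toNNReal _ (Real.exp_pos _).le, mul_comm]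
      simpa [hα0, Prod.dist_eq] using this
    exact continuous_fst.comp hL.continuous
  obtain ⟨d, hd⟩ := surjective_of_continuous_of_expanding one_pos hcontφ hexpand 0
  have hco1 : ContinuousOn (fun t => (α d t).1) (Icc a b) := fun t ht =>
    (hα1 d t ht).continuousWithinAt
  have hco2 : ContinuousOn (fun t => (α d t).2) (Icc a b) := fun t ht =>
    (hα2 d t ht).continuousWithinAt
  refine ⟨fun t => (α d t).1, fun t => (α d t).2, fun t => g t (α d t).1 (α d t).2,
    ⟨⟨hα1 d, hco2, fun t ht => ?_, ?_⟩, fun _ _ => rfl, by simp [hα0], hd⟩, ?_⟩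
  · exact (hα2 d t (Ioo_subset_Icc_self ht)).hasDerivAt (Icc_mem_nhds ht.1 ht.2)
  · exact (hcont _ _ hco1 hco2).mono Ioo_subset_Icc_self
  · rintro v v' v'' ⟨hv, hv'c, hv', -⟩ heq hvc hvb
    have hvco : ContinuousOn v (Icc a b) := fun t ht => (hv t ht).continuousWithinAt
    have hv2 := hasDerivWithinAt_Icc_of_continuousOn hab hv'c
      (g := fun t => g t (v t) (v' t)) (fun t ht => heq t ht ▸ hv' t ht) (hcont _ _ hvco hv'c)
    have heqOn : EqOn (fun t => (v t, v' t)) (α (v c)) (Icc a b) :=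
      eqOn_Icc_of_hasDerivWithinAt hV hc' (fun t ht => (hv t ht).prodMk (hv2 t ht))
        (hα (v c)) (by simp [hα0, hvc])
    have hb : (α (v c) b).1 = 0 := by
      rw [← heqOn (right_mem_Icc.2 hab.le)]
      exact hvb
    have hvd : v c = d := by
      rcases le_total (v c) d with h | h
      · linarith [hexpand _ _ h]
      · linarith [hexpand _ _ h]
    intro t ht
    rw [← hvd]
    exact congrArg Prod.fst (heqOn ht)

/-- Two-sided ellipticity makes a fully nonlinear operator strongly monotone in the second
derivative. -/
lemma mul_abs_sub_le_of_elliptic {lam Lam gam del : ℝ} {Φ : ℝ → ℝ → ℝ → ℝ}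
    (hΦ : ∀ m p u m' p' u' : ℝ,
      lam * max (m - m') 0 - Lam * max (-(m - m')) 0 - gam * |p - p'| - del * |u - u'|
          ≤ Φ m p u - Φ m' p' u')
    (m p u m' p' u' : ℝ) :
    lam * |m - m'| ≤ |Φ m p u - Φ m' p' u'| + gam * |p - p'| + del * |u - u'| := by
  rcases le_total m' m with h | h
  · have := hΦ m p u m' p' u'
    rw [max_eq_left (by linarith), max_eq_right (by linarith)] at this
    rw [abs_of_nonneg (sub_nonneg.2 h)]
    linarith [le_abs_self (Φ m p u - Φ m' p' u')]
  · have := hΦ m' p' u' m p u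
    rw [max_eq_left (by linarith), max_eq_right (by linarith), abs_sub_comm p', abs_sub_comm u']
      at this
    rw [abs_of_nonpos (sub_nonpos.2 h)]
    linarith [neg_abs_le (Φ m p u - Φ m' p' u')]

/-- there is `κ > 0` such that for every `c ∈ [a,b)` the mixed problem
`F(u'',u',u,t) - κ u = f` in `(a,b)`, `u'(c) = 0`, `u(b) = 0`, is uniquely solvable for
every continuous right-hand side `f`. -/
theorem stmt_5
    (a b lam Lam gam del : ℝ) (hab : a < b)
    (hlam : 0 < lam) (hLam : lam ≤ Lam) (hgam : 0 < gam) (hdel : 0 < del)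
    (F : ℝ → ℝ → ℝ → ℝ → ℝ)
    (hFcont : ContinuousOn (fun z : ℝ × ℝ × ℝ × ℝ => F z.1 z.2.1 z.2.2.1 z.2.2.2)
      {z : ℝ × ℝ × ℝ × ℝ | z.2.2.2 ∈ Icc a b})
    (hF1 : ∀ s : ℝ, 0 ≤ s → ∀ m p u : ℝ, ∀ t ∈ Icc a b,
      F (s * m) (s * p) (s * u) t = s * F m p u t)
    (hF2 : ∀ m p u m' p' u' : ℝ, ∀ t ∈ Icc a b,
      lam * max (m - m') 0 - Lam * max (-(m - m')) 0 - gam * |p - p'| - del * |u - u'|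
          ≤ F m p u t - F m' p' u' t ∧
        F m p u t - F m' p' u' t
          ≤ Lam * max (m - m') 0 - lam * max (-(m - m')) 0 + gam * |p - p'| + del * |u - u'|)
    (hF3 : ∀ m p u m' p' u' : ℝ, ∀ t ∈ Icc a b,
      -F (m' - m) (p' - p) (u' - u) t ≤ F m p u t - F m' p' u' t ∧
        F m p u t - F m' p' u' t ≤ F (m - m') (p - p') (u - u') t) :
    ∃ κ : ℝ, 0 < κ ∧
      ∀ c ∈ Ico a b, ∀ f : ℝ → ℝ, ContinuousOn f (Icc a b) →
        ∃ u u' u'' : ℝ → ℝ,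
          (C2Fun a b u u' u'' ∧
            (∀ t ∈ Ioo a b, F (u'' t) (u' t) (u t) t - κ * u t = f t) ∧
            u' c = 0 ∧ u b = 0) ∧
          ∀ v v' v'' : ℝ → ℝ,
            C2Fun a b v v' v'' →
            (∀ t ∈ Ioo a b, F (v'' t) (v' t) (v t) t - κ * v t = f t) →
            v' c = 0 → v b = 0 →
            ∀ t ∈ Icc a b, v t = u t := by
  refine ⟨del + 1, by linarith, fun c hc f hf => ?_⟩
  have hell : ∀ t ∈ Icc a b, ∀ m p u m' p' u' : ℝ, lam * |m - m'| ≤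
      |F m p u t - F m' p' u' t| + gam * |p - p'| + del * |u - u'| := fun t ht =>
    mul_abs_sub_le_of_elliptic (Φ := fun m p u => F m p u t)
      fun m p u m' p' u' => (hF2 m p u m' p' u' t ht).1
  have hsurj : ∀ t ∈ Icc a b, ∀ p u, Function.Surjective fun m => F m p u t := by
    intro t ht p u
    refine surjective_of_continuous_of_expanding hlam ?_ fun x y hxy => ?_
    · exact hFcont.comp_continuous (f := fun m => (m, p, u, t)) (by fun_prop) fun _ => ht
    · have := (hF2 y p u x p u t ht).1
      rw [max_eq_left (by linarith), max_eq_right (by linarith)] at this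
      simpa using this
  have hG : ∀ t u p, ∃ m, t ∈ Icc a b → F m p u t - (del + 1) * u = f t := by
    intro t u p
    by_cases ht : t ∈ Icc a b
    · obtain ⟨m, hm⟩ := hsurj t ht p u (f t + (del + 1) * u)
      exact ⟨m, fun _ => sub_eq_iff_eq_add.2 hm⟩
    · exact ⟨0, fun h => absurd h ht⟩
  choose g hg using hG
  have hg_unique : ∀ t ∈ Icc a b, ∀ m u p, F m p u t - (del + 1) * u = f t → m = g t u p := by
    intro t ht m u p hm
    have h := hell t ht m p u (g t u p) p u
    rw [show F m p u t - F (g t u p) p u t = 0 by linarith [hg t u p ht]] at h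
    simp only [sub_self, abs_zero, mul_zero, add_zero] at h
    exact sub_eq_zero.1 (abs_nonpos_iff.1 (nonpos_of_mul_nonpos_right h hlam))
  have hK : 0 ≤ (gam + 2 * del + 1) / lam := by positivity
  have hlip : ∀ t ∈ Icc a b, ∀ x p y q, |g t x p - g t y q| ≤
      NNReal.mk ((gam + 2 * del + 1) / lam) hK * max |x - y| |p - q| := by
    intro t ht x p y q
    have h := hell t ht (g t x p) p x (g t y q) q y
    rw [show F (g t x p) p x t - F (g t y q) q y t = (del + 1) * (x - y) by
      linarith [hg t x p ht, hg t y q ht], abs_mul, abs_of_pos (by linarith : 0 < del + 1)] at h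
    have h1 := mul_le_mul_of_nonneg_left (le_max_right |x - y| |p - q|) hgam.le
    have h2 := mul_le_mul_of_nonneg_left (le_max_left |x - y| |p - q|)
      (by linarith : 0 ≤ 2 * del + 1)
    rw [NNReal.coe_mk, div_mul_eq_mul_div, le_div_iff₀ hlam]
    linarith
  have hcont : ∀ x p : ℝ → ℝ, ContinuousOn x (Icc a b) → ContinuousOn p (Icc a b) →
      ContinuousOn (fun t => g t (x t) (p t)) (Icc a b) := by
    intro x p hx hp s hs
    have hF : Tendsto (fun t => F (g s (x s) (p s)) (p t) (x t) t) (𝓝[Icc a b] s)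
        (𝓝 (F (g s (x s) (p s)) (p s) (x s) s)) :=
      (hFcont.comp (f := fun t => (g s (x s) (p s), p t, x t, t)) (s := Icc a b)
        (by fun_prop) fun t ht => ht) s hs
    have hy : Tendsto (fun t => f t + (del + 1) * x t) (𝓝[Icc a b] s)
        (𝓝 (f s + (del + 1) * x s)) := (hf s hs).add ((hx s hs).const_mul _)
    have hlim : Tendsto (fun t => |f t + (del + 1) * x t - F (g s (x s) (p s)) (p t) (x t) t| / lam)
        (𝓝[Icc a b] s) (𝓝 0) := by
      have h := ((hy.sub hF).abs).div_const lam
      rwa [show f s + (del + 1) * x s - F (g s (x s) (p s)) (p s) (x s) s = 0 by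
        linarith [hg s (x s) (p s) hs], abs_zero, zero_div] at h
    refine tendsto_iff_dist_tendsto_zero.2
      (squeeze_zero' (Eventually.of_forall fun _ => dist_nonneg) ?_ hlim)
    filter_upwards [self_mem_nhdsWithin] with t ht
    have h := hell t ht (g t (x t) (p t)) (p t) (x t) (g s (x s) (p s)) (p t) (x t)
    rw [show F (g t (x t) (p t)) (p t) (x t) t = f t + (del + 1) * x t by
      linarith [hg t (x t) (p t) ht]] at h
    rw [Real.dist_eq, le_div_iff₀ hlam]
    simp only [sub_self, abs_zero, mul_zero, add_zero] at h
    linarith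
  have hmono : ∀ t ∈ Icc a b, ∀ p x y, x < y → g t x p < g t y p := by
    intro t ht p x y hxy
    by_contra! hle
    have h := (hF2 (g t y p) p y (g t x p) p x t ht).2
    rw [max_eq_right (by linarith), max_eq_left (by linarith), sub_self, abs_zero,
      abs_of_pos (sub_pos.2 hxy)] at h
    nlinarith [hg t x p ht, hg t y p ht, mul_nonneg hlam.le (sub_nonneg.2 hle)]
  obtain ⟨u, u', u'', ⟨hC2, hu, huc, hub⟩, huniq⟩ := exists_unique_mixed_problem hc hlip hcont hmono
  refine ⟨u, u', u'', ⟨hC2, fun t ht => ?_, huc, hub⟩, fun v v' v'' hv hveq => ?_⟩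
  · rw [hu t ht]
    exact hg t _ _ (Ioo_subset_Icc_self ht)
  · exact huniq v v' v'' hv fun t ht =>
      hg_unique t (Ioo_subset_Icc_self ht) _ _ _ (hveq t ht)
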